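/- Let A be a C*-algebra, Ω a compact subset of ℂ, and let φ₁, …, φₙ and ψ₁, …, ψₙ be *-homomorphisms from C(Ω, ℂ) to A such that φᵢ(f) · φⱼ(g) = 0 and ψᵢ(f) · ψⱼ(g) = 0 for all f, g ∈ C(Ω, ℂ) whenever i ≠ j. Then the pointwise sums φ = Σᵢ φᵢ and ψ = Σᵢ ψᵢ are *-homomorphisms and d_W(φ, ψ) ≤ min over all permutations σ of {1, …, n} of max_{1 ≤ i ≤ n} d_W(φᵢ, ψ_{σ(i)}). -/

import Mathlib

open Filter Topology
open scoped ENNReal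

/-- Cuntz subequivalence of elements of a C*-algebra: `a ≾ b` iff there is a sequence `rₙ`
with `‖rₙ* b rₙ - a‖ → 0`. -/
def CuntzLE {A : Type*} [NonUnitalNormedRing A] [StarRing A] (a b : A) : Prop :=
  ∃ r : ℕ → A, Tendsto (fun n => ‖star (r n) * b * r n - a‖) atTop (nhds 0)

/-- `O` is a relatively open subset of `Ω`. -/
def RelOpen (Ω O : Set ℂ) : Prop := ∃ U : Set ℂ, IsOpen U ∧ O = U ∩ Ω

/-- The function `f_O : ℂ → ℂ`, equal to `min 1 (dist z (Ω \ O))` (with the convention that the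
distance to the empty set is `∞`); its restriction to `Ω` is supported exactly on `O`. -/
noncomputable def fOFun (Ω O : Set ℂ) : ℂ → ℂ :=
  fun z => (((min 1 (EMetric.infEdist z (Ω \ O))).toReal : ℝ) : ℂ)

lemma continuous_fOFun (Ω O : Set ℂ) : Continuous (fOFun Ω O) := by
  apply Complex.continuous_ofReal.comp
  apply ENNReal.continuousOn_toReal.comp_continuous
    (continuous_const.min EMetric.continuous_infEdist)
  intro z
  exact ne_top_of_le_ne_top ENNReal.one_ne_top (min_le_left _ _)

/-- `f_O` as an element of `C(Ω, ℂ)`. -/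
noncomputable def fO (Ω O : Set ℂ) : C(Ω, ℂ) :=
  ⟨fun z => fOFun Ω O z, (continuous_fOFun Ω O).comp continuous_subtype_val⟩

/-- `O_r = {x ∈ Ω | dist (x, O) < r}`. -/
def thicken (Ω O : Set ℂ) (r : ℝ) : Set ℂ := {x | x ∈ Ω ∧ Metric.infDist x O < r}

/-- The Cuntz distance `d_W` between two maps `C(Ω, ℂ) → A`, with values in `[0, ∞]`
(the infimum of the empty set being `∞`). -/
noncomputable def dW {A : Type*} [NonUnitalNormedRing A] [StarRing A]
    (Ω : Set ℂ) (φ ψ : C(Ω, ℂ) → A) : ℝ≥0∞ :=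
  sInf {e : ℝ≥0∞ | ∃ r : ℝ, 0 < r ∧ e = ENNReal.ofReal r ∧
    ∀ O : Set ℂ, RelOpen Ω O →
      CuntzLE (φ (fO Ω O)) (ψ (fO Ω (thicken Ω O r))) ∧
      CuntzLE (ψ (fO Ω O)) (φ (fO Ω (thicken Ω O r)))}


/-- Cuntz subequivalence is transitive. -/
lemma CuntzLE.trans {A : Type*} [NonUnitalCStarAlgebra A] {a b c : A}
    (hab : CuntzLE a b) (hbc : CuntzLE b c) : CuntzLE a c := by
  obtain ⟨r, hr⟩ := hab
  obtain ⟨s, hs⟩ := hbc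
  rw [← tendsto_iff_norm_sub_tendsto_zero] at hr hs
  have hex : ∀ k : ℕ, ∃ t : A, ‖star t * c * t - a‖ < 1 / ((k : ℝ) + 1) := by
    intro k
    have hk : (0 : ℝ) < 1 / ((k : ℝ) + 1) := by positivity
    obtain ⟨m, hm⟩ := (hr.eventually (Metric.ball_mem_nhds a hk)).exists
    have hsm : Tendsto (fun n => star (r m) * (star (s n) * c * s n) * r m) atTop
        (𝓝 (star (r m) * b * r m)) :=
      (hs.const_mul (star (r m))).mul_const (r m)
    obtain ⟨n, hn⟩ := (hsm.eventually (Metric.isOpen_ball.mem_nhds hm)).exists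
    refine ⟨s n * r m, ?_⟩
    rw [dist_eq_norm] at hn
    simpa only [star_mul, mul_assoc] using hn
  choose t ht using hex
  exact ⟨t, squeeze_zero (fun _ => norm_nonneg _) (fun k => (ht k).le)
    tendsto_one_div_add_atTop_nhds_zero_nat⟩

lemma thicken_mono (Ω O : Set ℂ) {r s : ℝ} (h : r ≤ s) : thicken Ω O r ⊆ thicken Ω O s :=
  fun _ hx => ⟨hx.1, hx.2.trans_le h⟩

/-- The real-valued function underlying `fOFun`. -/
noncomputable def truncDist (Ω O : Set ℂ) (z : ℂ) : ℝ :=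
  (min 1 (Metric.infEDist z (Ω \ O))).toReal

lemma truncDist_nonneg (Ω O : Set ℂ) (z : ℂ) : 0 ≤ truncDist Ω O z := ENNReal.toReal_nonneg

lemma continuous_truncDist (Ω O : Set ℂ) : Continuous (truncDist Ω O) :=
  Complex.continuous_re.comp (continuous_fOFun Ω O)

lemma truncDist_mono (Ω : Set ℂ) {O P : Set ℂ} (h : O ⊆ P) (z : ℂ) :
    truncDist Ω O z ≤ truncDist Ω P z :=
  ENNReal.toReal_mono (ne_top_of_le_ne_top ENNReal.one_ne_top (min_le_left _ _))
    (min_le_min_left _ (Metric.infEDist_anti (Set.sdiff_subset_sdiff_right h)))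

/-- Images of the functions `f_O` are Cuntz-monotone in `O`. -/
lemma cuntzLE_map_fO {A : Type*} [NonUnitalCStarAlgebra A] {Ω : Set ℂ} (hΩ : IsCompact Ω)
    (ψ : C(Ω, ℂ) →⋆ₙₐ[ℂ] A) {O P : Set ℂ} (h : O ⊆ P) :
    CuntzLE (ψ (fO Ω O)) (ψ (fO Ω P)) := by
  have : CompactSpace Ω := isCompact_iff_compactSpace.mp hΩ
  have hε : ∀ k : ℕ, (0 : ℝ) < 1 / ((k : ℝ) + 1) := fun k => by positivity
  have hden : ∀ (k : ℕ) (z : ℂ), 0 < truncDist Ω P z + 1 / ((k : ℝ) + 1) := fun k z =>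
    add_pos_of_nonneg_of_pos (truncDist_nonneg Ω P z) (hε k)
  let q : ℕ → ℂ → ℝ := fun k z => √(truncDist Ω O z / (truncDist Ω P z + 1 / ((k : ℝ) + 1)))
  have hq : ∀ k, Continuous (q k) := fun k =>
    Real.continuous_sqrt.comp ((continuous_truncDist Ω O).div
      ((continuous_truncDist Ω P).add continuous_const) fun z => (hden k z).ne')
  let u : ℕ → C(Ω, ℂ) := fun k =>
    ⟨fun z => (q k z : ℂ), Complex.continuous_ofReal.comp ((hq k).comp continuous_subtype_val)⟩
  refine ⟨fun k => ψ (u k), squeeze_zero (fun _ => norm_nonneg _) (fun k => ?_)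
    tendsto_one_div_add_atTop_nhds_zero_nat⟩
  rw [← map_star, ← map_mul, ← map_mul, ← map_sub]
  refine (NonUnitalStarAlgHom.norm_apply_le ψ _).trans
    ((ContinuousMap.norm_le _ (hε k).le).mpr fun z => ?_)
  have hval : (star (u k) * fO Ω P * u k - fO Ω O) z =
      ((q k z * truncDist Ω P z * q k z - truncDist Ω O z : ℝ) : ℂ) := by
    have hf : ∀ V, fOFun Ω V z = truncDist Ω V z := fun _ => rfl
    simp [u, fO, hf]
  rw [hval, Complex.norm_real, Real.norm_eq_abs]
  have hO := truncDist_nonneg Ω O z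
  have hOP := truncDist_mono Ω h z
  have hd := hden k z
  have hsq : q k z * q k z = truncDist Ω O z / (truncDist Ω P z + 1 / ((k : ℝ) + 1)) :=
    Real.mul_self_sqrt (div_nonneg hO hd.le)
  have hdiff : q k z * truncDist Ω P z * q k z - truncDist Ω O z =
      -(1 / ((k : ℝ) + 1) * (truncDist Ω O z / (truncDist Ω P z + 1 / ((k : ℝ) + 1)))) := by
    rw [mul_right_comm, hsq]
    generalize 1 / ((k : ℝ) + 1) = ε at hd
    field_simp
    ring
  rw [hdiff, abs_neg, abs_of_nonneg (mul_nonneg (hε k).le (div_nonneg hO hd.le))]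
  exact mul_le_of_le_one_right (hε k).le
    ((div_le_one hd).mpr (hOP.trans (le_add_of_nonneg_right (hε k).le)))

/-- Cuntz subequivalence is additive over orthogonal *-homomorphisms on the larger side. -/
lemma CuntzLE.sum_of_orthogonal {A B ι : Type*} [NonUnitalCStarAlgebra A] [Fintype ι]
    [Semiring B] [Algebra ℂ B] [StarRing B] {ψ : ι → (B →⋆ₙₐ[ℂ] A)}
    (hψ : ∀ i j, i ≠ j → ∀ f g : B, ψ i f * ψ j g = 0)
    {a : ι → A} {g : B} (h : ∀ i, CuntzLE (a i) (ψ i g)) :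
    CuntzLE (∑ i, a i) (∑ i, ψ i g) := by
  choose r hr using h
  simp only [← tendsto_iff_norm_sub_tendsto_zero] at hr
  refine ⟨fun n => ∑ i, ψ i 1 * r i n, ?_⟩
  rw [← tendsto_iff_norm_sub_tendsto_zero]
  refine (tendsto_finsetSum Finset.univ fun i _ => hr i).congr fun n => ?_
  have hmul : ∀ i, (∑ j, ψ j g) * (ψ i 1 * r i n) = ψ i g * r i n := by
    intro i
    rw [← mul_assoc, Finset.sum_mul, Finset.sum_eq_single_of_mem i (Finset.mem_univ i)
      fun j _ hji => hψ j i hji g 1, ← map_mul, mul_one]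
  rw [mul_assoc, Finset.mul_sum, star_sum, Finset.sum_mul_sum]
  refine Finset.sum_congr rfl fun i _ => ?_
  rw [Finset.sum_eq_single_of_mem i (Finset.mem_univ i)]
  · rw [hmul, star_mul, ← map_star, star_one, mul_assoc, mul_assoc, ← mul_assoc (ψ i 1),
      ← map_mul, one_mul]
  · intro j _ hji
    rw [hmul, star_mul, ← map_star, star_one, mul_assoc, ← mul_assoc (ψ i 1),
      hψ i j hji.symm, zero_mul, mul_zero]

/-- The pointwise sum of *-homomorphisms with mutually orthogonal ranges. -/
def orthogonalSum {A B ι : Type*} [NonUnitalCStarAlgebra A] [Fintype ι]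
    [Semiring B] [Algebra ℂ B] [StarRing B] (ψ : ι → (B →⋆ₙₐ[ℂ] A))
    (hψ : ∀ i j, i ≠ j → ∀ f g : B, ψ i f * ψ j g = 0) : B →⋆ₙₐ[ℂ] A where
  toFun f := ∑ i, ψ i f
  map_smul' c f := by simp [Finset.smul_sum]
  map_zero' := by simp
  map_add' f g := by simp [Finset.sum_add_distrib]
  map_mul' f g := by
    rw [Finset.sum_mul_sum]
    refine Finset.sum_congr rfl fun i _ => ?_
    rw [map_mul, Finset.sum_eq_single_of_mem i (Finset.mem_univ i)
      fun j _ hji => hψ i j hji.symm f g]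
  map_star' f := by simp [map_star]

/-- Every radius strictly above the Cuntz distance is admissible in its definition. -/
lemma cuntzLE_thicken_of_dW_lt {A : Type*} [NonUnitalCStarAlgebra A] {Ω : Set ℂ}
    (hΩ : IsCompact Ω) {φ ψ : C(Ω, ℂ) →⋆ₙₐ[ℂ] A} {s : ℝ}
    (h : dW Ω φ ψ < ENNReal.ofReal s) {O : Set ℂ} (hO : RelOpen Ω O) :
    CuntzLE (φ (fO Ω O)) (ψ (fO Ω (thicken Ω O s))) ∧
      CuntzLE (ψ (fO Ω O)) (φ (fO Ω (thicken Ω O s))) := by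
  obtain ⟨_, ⟨r, hr, rfl, hrO⟩, hrs⟩ := sInf_lt_iff.mp h
  have hsub := thicken_mono Ω O (ENNReal.ofReal_lt_ofReal_iff'.mp hrs).1.le
  exact ⟨(hrO O hO).1.trans (cuntzLE_map_fO hΩ ψ hsub),
    (hrO O hO).2.trans (cuntzLE_map_fO hΩ φ hsub)⟩

/-- Let `A` be a C*-algebra, `Ω` a compact subset of `ℂ`, and `φ₁, …, φₙ`, `ψ₁, …, ψₙ`
*-homomorphisms `C(Ω, ℂ) → A` with mutually orthogonal ranges (`φᵢ(f)·φⱼ(g) = 0` and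
`ψᵢ(f)·ψⱼ(g) = 0` for `i ≠ j`).  Then the pointwise sums `φ = Σᵢ φᵢ` and `ψ = Σᵢ ψᵢ` are
*-homomorphisms and
`d_W(φ, ψ) ≤ min_{σ ∈ Sₙ} max_{1 ≤ i ≤ n} d_W(φᵢ, ψ_{σ(i)})`. -/
theorem statement9 {A : Type*} [NonUnitalCStarAlgebra A]
    (Ω : Set ℂ) (hΩ : IsCompact Ω) (n : ℕ)
    (φ ψ : Fin n → (C(Ω, ℂ) →⋆ₙₐ[ℂ] A))
    (hφ : ∀ i j, i ≠ j → ∀ f g : C(Ω, ℂ), φ i f * φ j g = 0)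
    (hψ : ∀ i j, i ≠ j → ∀ f g : C(Ω, ℂ), ψ i f * ψ j g = 0) :
    ∃ Φ Ψ : C(Ω, ℂ) →⋆ₙₐ[ℂ] A,
      (∀ f : C(Ω, ℂ), Φ f = ∑ i, φ i f) ∧
      (∀ f : C(Ω, ℂ), Ψ f = ∑ i, ψ i f) ∧
      dW Ω ⇑Φ ⇑Ψ ≤ ⨅ σ : Equiv.Perm (Fin n), ⨆ i : Fin n, dW Ω ⇑(φ i) ⇑(ψ (σ i)) := by
  refine ⟨orthogonalSum φ hφ, orthogonalSum ψ hψ, fun _ => rfl, fun _ => rfl,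
    le_iInf fun σ => le_of_forall_gt fun e he => ?_⟩
  obtain ⟨s, -, hs, hse⟩ := ENNReal.lt_iff_exists_real_btwn.mp he
  have hs0 : 0 < s := ENNReal.ofReal_pos.mp (bot_le.trans_lt hs)
  refine lt_of_le_of_lt (sInf_le ⟨s, hs0, rfl, fun O hO => ?_⟩) hse
  have key i := cuntzLE_thicken_of_dW_lt hΩ
    ((le_iSup (fun i => dW Ω (φ i) (ψ (σ i))) i).trans_lt hs) hO
  have hψσ : ∀ i j, i ≠ j → ∀ f g : C(Ω, ℂ), ψ (σ i) f * ψ (σ j) g = 0 :=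
    fun i j hij => hψ _ _ (σ.injective.ne hij)
  have hsum (f : C(Ω, ℂ)) : orthogonalSum ψ hψ f = ∑ i, ψ (σ i) f :=
    (Equiv.sum_comp σ fun i => ψ i f).symm
  rw [hsum, hsum]
  exact ⟨CuntzLE.sum_of_orthogonal (ψ := fun i => ψ (σ i)) hψσ fun i => (key i).1,
    CuntzLE.sum_of_orthogonal hφ fun i => (key i).2⟩
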